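/- arXiv:2106.02397 — 7 statements merged into one kernel-verified Lean document; each statement's English description precedes it below -/
import Mathlib

section
/- Let δ > 0 and let f : ℝ → ℝ satisfy |f(t) − t²| ≤ (1/10)|t|³ for all t with |t| ≤ δ. Let ε be a real number with 0 < ε ≤ 1/100 and 2ε ≤ δ. Then ε³ ≤ f(ε + f(ε)) − f(ε) ≤ 3ε³. -/
theorem stmt_2 (δ : ℝ) (hδ : 0 < δ) (f : ℝ → ℝ)
    (hf : ∀ t : ℝ, |t| ≤ δ → |f t - t ^ 2| ≤ (1 / 10) * |t| ^ 3)
    (ε : ℝ) (hε : 0 < ε) (hε1 : ε ≤ 1 / 100) (hε2 : 2 * ε ≤ δ) :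
    ε ^ 3 ≤ f (ε + f ε) - f ε ∧ f (ε + f ε) - f ε ≤ 3 * ε ^ 3 := by
  have h1 := hf ε (by rw [abs_of_pos hε]; linarith)
  rw [abs_of_pos hε, abs_le] at h1
  obtain ⟨h1l, h1u⟩ := h1
  have hsq : ε ^ 2 ≤ ε / 100 := by nlinarith
  have hcube : ε ^ 3 ≤ ε ^ 2 / 100 := by nlinarith [sq_nonneg ε]
  have hcube_pos : 0 < ε ^ 3 := by positivity
  have hsq_pos : 0 < ε ^ 2 := by positivity
  have hyl : 999 / 1000 * ε ^ 2 ≤ f ε := by linarith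
  have hyu : f ε ≤ 1001 / 1000 * ε ^ 2 := by linarith
  generalize f ε = y at *
  have hy : 0 ≤ y := by linarith
  have hs : 0 < ε + y := by linarith
  have hsu : ε + y ≤ 102 / 100 * ε := by linarith
  have h2 := hf (ε + y) (by rw [abs_of_pos hs]; linarith)
  rw [abs_of_pos hs, abs_le] at h2
  obtain ⟨h2l, h2u⟩ := h2
  have hs3 : (ε + y) ^ 3 ≤ (102 / 100 * ε) ^ 3 := by gcongr
  have hεyl : 999 / 1000 * ε ^ 3 ≤ ε * y := by nlinarith
  have hεyu : ε * y ≤ 1001 / 1000 * ε ^ 3 := by nlinarith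
  have hyy : y ^ 2 ≤ 2 / 100 * (ε * y) := by nlinarith
  have hexp : (ε + y) ^ 2 = ε ^ 2 + 2 * (ε * y) + y ^ 2 := by ring
  have hcexp : (102 / 100 * ε) ^ 3 = (102 / 100) ^ 3 * ε ^ 3 := by ring
  constructor
  · nlinarith [sq_nonneg y]
  · nlinarith [sq_nonneg y]
end

section
/- Let ε > 0 and let f : ℝ → ℝ satisfy |f(t) − t²| ≤ (1/10)|t|³ for all t with |t| ≤ 2ε. Let x, y ∈ [−1, 1] with y = x². Then |f(ε) + 2·f(ε·x) + f(ε·y) − f(ε + ε·y)| ≤ (6/5)·ε³. -/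
theorem stmt_3 (ε : ℝ) (hε : 0 < ε) (f : ℝ → ℝ)
    (hf : ∀ t : ℝ, |t| ≤ 2 * ε → |f t - t ^ 2| ≤ (1 / 10) * |t| ^ 3)
    (x y : ℝ) (hx : x ∈ Set.Icc (-1 : ℝ) 1) (hy : y ∈ Set.Icc (-1 : ℝ) 1)
    (hxy : y = x ^ 2) :
    |f ε + 2 * f (ε * x) + f (ε * y) - f (ε + ε * y)| ≤ (6 / 5) * ε ^ 3 := by
  have bound (t c : ℝ) (ht : |t| ≤ c) (hc : c ≤ 2 * ε) :
      |f t - t ^ 2| ≤ (1 / 10) * c ^ 3 :=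
    (hf t (ht.trans hc)).trans (by gcongr)
  have scaled {z : ℝ} (hz : z ∈ Set.Icc (-1 : ℝ) 1) : |ε * z| ≤ ε := by
    rw [abs_mul, abs_of_pos hε]
    exact mul_le_of_le_one_right hε.le (abs_le.mpr hz)
  have h₁ := abs_le.mp (bound ε ε (abs_of_pos hε).le (by linarith))
  have h₂ := abs_le.mp (bound (ε * x) ε (scaled hx) (by linarith))
  have h₃ := abs_le.mp (bound (ε * y) ε (scaled hy) (by linarith))
  have h_sum : |ε + ε * y| ≤ 2 * ε := by
    have := abs_add_le ε (ε * y)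
    linarith [scaled hy, abs_of_pos hε]
  have h₄ := abs_le.mp (bound (ε + ε * y) (2 * ε) h_sum le_rfl)
  have cancel : ε ^ 2 + 2 * (ε * x) ^ 2 + (ε * y) ^ 2 - (ε + ε * y) ^ 2 = 0 := by
    rw [hxy]
    ring
  have cube : (2 * ε) ^ 3 = 8 * ε ^ 3 := by ring
  rw [cube] at h₄
  exact abs_le.mpr ⟨by linarith [h₁.1, h₂.1, h₃.1, h₄.2],
    by linarith [h₁.2, h₂.2, h₃.2, h₄.1]⟩
end

section
/- Let ε > 0 and let f : ℝ → ℝ satisfy |f(t) − t²| ≤ (1/10)|t|³ for all t with |t| ≤ 2ε. Let x, y ∈ [−1, 1]. If |f(ε) + 2·f(ε·x) + f(ε·y) − f(ε + ε·y)| ≤ 6·ε³, then |y − x²| ≤ 100·ε. -/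
theorem stmt_4 (ε : ℝ) (hε : 0 < ε) (f : ℝ → ℝ)
    (hf : ∀ t : ℝ, |t| ≤ 2 * ε → |f t - t ^ 2| ≤ (1 / 10) * |t| ^ 3)
    (x y : ℝ) (hx : x ∈ Set.Icc (-1 : ℝ) 1) (hy : y ∈ Set.Icc (-1 : ℝ) 1)
    (hres : |f ε + 2 * f (ε * x) + f (ε * y) - f (ε + ε * y)| ≤ 6 * ε ^ 3) :
    |y - x ^ 2| ≤ 100 * ε := by
  have key : ∀ s : ℝ, |s| ≤ 2 → |f (ε * s) - (ε * s) ^ 2| ≤ 8 / 10 * ε ^ 3 := by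
    intro s hs
    have habs : |ε * s| ≤ 2 * ε := by
      rw [abs_mul, abs_of_pos hε]
      nlinarith
    have hcube : |ε * s| ^ 3 ≤ (2 * ε) ^ 3 := by gcongr
    linarith [hf _ habs]
  obtain ⟨hx₁, hx₂⟩ := hx
  obtain ⟨hy₁, hy₂⟩ := hy
  have h₁ := abs_le.mp (key 1 (by norm_num))
  have h₂ := abs_le.mp (key x (abs_le.mpr ⟨by linarith, by linarith⟩))
  have h₃ := abs_le.mp (key y (abs_le.mpr ⟨by linarith, by linarith⟩))
  have h₄ := abs_le.mp (key (1 + y) (abs_le.mpr ⟨by linarith, by linarith⟩))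
  rw [mul_one] at h₁
  rw [mul_add, mul_one] at h₄
  have hr := abs_le.mp hres
  have hε2 : 0 < ε ^ 2 := by positivity
  have hε3 : 0 < ε ^ 3 := by positivity
  rw [abs_le]
  constructor
  · refine le_of_mul_le_mul_left ?_ hε2
    linarith
  · refine le_of_mul_le_mul_left ?_ hε2
    linarith
end

section
/- Let δ > 0 and let f, g : ℝ → ℝ satisfy |f(t) − t²| ≤ (1/10)|t|³ and |g(t) − t²| ≤ (1/10)|t|³ for all t with |t| ≤ δ. Let ε be a real number with 0 < ε ≤ 1/100 and 2ε ≤ δ. Then g(ε + g(ε)) − f(ε) ≥ ε³. -/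
theorem stmt_7 (δ : ℝ) (hδ : 0 < δ) (f g : ℝ → ℝ)
    (hf : ∀ t : ℝ, |t| ≤ δ → |f t - t ^ 2| ≤ (1 / 10) * |t| ^ 3)
    (hg : ∀ t : ℝ, |t| ≤ δ → |g t - t ^ 2| ≤ (1 / 10) * |t| ^ 3)
    (ε : ℝ) (hε : 0 < ε) (hε1 : ε ≤ 1 / 100) (hε2 : 2 * ε ≤ δ) :
    ε ^ 3 ≤ g (ε + g ε) - f ε := by
  have hfε := hf ε (by rw [abs_of_pos hε]; linarith)
  have hgε := hg ε (by rw [abs_of_pos hε]; linarith)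
  rw [abs_of_pos hε, abs_le] at hfε hgε
  have hε_sq : 0 < ε ^ 2 := by positivity
  have hε_cube : 0 < ε ^ 3 := by positivity
  have sq_le : ε ^ 2 ≤ ε / 100 := by nlinarith
  have cube_le : ε ^ 3 ≤ ε ^ 2 / 100 := by nlinarith
  have g_lower : 999 / 1000 * ε ^ 2 ≤ g ε := by linarith [hgε.1]
  have g_upper : g ε ≤ ε / 10 := by linarith [hgε.2]
  have arg_pos : 0 < ε + g ε := by linarith
  have hgs := hg (ε + g ε) (by rw [abs_of_pos arg_pos]; linarith)
  rw [abs_of_pos arg_pos, abs_le] at hgs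
  have arg_cube : (ε + g ε) ^ 3 ≤ (11 / 10 * ε) ^ 3 :=
    pow_le_pow_left₀ arg_pos.le (by linarith) 3
  have mul_lower : ε * (999 / 1000 * ε ^ 2) ≤ ε * g ε :=
    mul_le_mul_of_nonneg_left g_lower hε.le
  nlinarith [hgs.1, hfε.2, sq_nonneg (g ε)]
end

section
/- Let ε > 0 and let f, g : ℝ → ℝ satisfy |f(t) − t²| ≤ (1/10)|t|³ and |g(t) − t²| ≤ (1/10)|t|³ for all t with |t| ≤ 2ε. Let x, y ∈ [−1, 1] with y = x². Then g(ε) + 2·g(ε·x) + g(ε·y) − f(ε + ε·y) ≥ −2·ε³ and f(ε) + 2·f(ε·x) + f(ε·y) − g(ε + ε·y) ≤ 2·ε³. -/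
/-- A cubic error bound for squaring at scale `ε` gives a uniform bound on multiples of `ε`. -/
theorem abs_sub_sq_le_of_cubic_error {ε : ℝ} (hε : 0 < ε) {h : ℝ → ℝ}
    (hh : ∀ t : ℝ, |t| ≤ 2 * ε → |h t - t ^ 2| ≤ (1 / 10) * |t| ^ 3)
    {c t : ℝ} (hc : c ≤ 2) (ht : |t| ≤ c * ε) :
    |h t - t ^ 2| ≤ (1 / 10) * (c ^ 3 * ε ^ 3) := by
  have ht' : |t| ≤ 2 * ε := ht.trans (by gcongr)
  calc |h t - t ^ 2| ≤ (1 / 10) * |t| ^ 3 := hh t ht'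
    _ ≤ (1 / 10) * (c * ε) ^ 3 := by gcongr
    _ = (1 / 10) * (c ^ 3 * ε ^ 3) := by ring

theorem stmt_8 (ε : ℝ) (hε : 0 < ε) (f g : ℝ → ℝ)
    (hf : ∀ t : ℝ, |t| ≤ 2 * ε → |f t - t ^ 2| ≤ (1 / 10) * |t| ^ 3)
    (hg : ∀ t : ℝ, |t| ≤ 2 * ε → |g t - t ^ 2| ≤ (1 / 10) * |t| ^ 3)
    (x y : ℝ) (hx : x ∈ Set.Icc (-1 : ℝ) 1) (hy : y ∈ Set.Icc (-1 : ℝ) 1)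
    (hxy : y = x ^ 2) :
    -2 * ε ^ 3 ≤ g ε + 2 * g (ε * x) + g (ε * y) - f (ε + ε * y) ∧
      f ε + 2 * f (ε * x) + f (ε * y) - g (ε + ε * y) ≤ 2 * ε ^ 3 := by
  obtain ⟨hx₁, hx₂⟩ := hx
  obtain ⟨hy₁, hy₂⟩ := hy
  have b₁ : |ε| ≤ 1 * ε := by rw [abs_of_pos hε, one_mul]
  have b₂ : |ε * x| ≤ 1 * ε := abs_le.2 ⟨by nlinarith, by nlinarith⟩
  have b₃ : |ε * y| ≤ 1 * ε := abs_le.2 ⟨by nlinarith, by nlinarith⟩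
  have b₄ : |ε + ε * y| ≤ 2 * ε := abs_le.2 ⟨by nlinarith, by nlinarith⟩
  have cancel : ε ^ 2 + 2 * (ε * x) ^ 2 + (ε * y) ^ 2 - (ε + ε * y) ^ 2 = 0 := by
    rw [hxy]; ring
  have hε₃ : 0 < ε ^ 3 := by positivity
  have key : ∀ {h : ℝ → ℝ}, (∀ t : ℝ, |t| ≤ 2 * ε → |h t - t ^ 2| ≤ (1 / 10) * |t| ^ 3) →
      ∀ {c t : ℝ}, c ≤ 2 → |t| ≤ c * ε →
        -((1 / 10) * (c ^ 3 * ε ^ 3)) ≤ h t - t ^ 2 ∧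
          h t - t ^ 2 ≤ (1 / 10) * (c ^ 3 * ε ^ 3) :=
    fun hh _ _ hc ht => abs_le.1 (abs_sub_sq_le_of_cubic_error hε hh hc ht)
  constructor
  · linarith [(key hg one_le_two b₁).1, (key hg one_le_two b₂).1, (key hg one_le_two b₃).1,
      (key hf le_rfl b₄).2]
  · linarith [(key hf one_le_two b₁).2, (key hf one_le_two b₂).2, (key hf one_le_two b₃).2,
      (key hg le_rfl b₄).1]
end

section
/- Let ε > 0 and let f, g : ℝ → ℝ satisfy |f(t) − t²| ≤ (1/10)|t|³ and |g(t) − t²| ≤ (1/10)|t|³ for all t with |t| ≤ 2ε. Let x, y ∈ [−1, 1]. If f(ε) + 2·f(ε·x) + f(ε·y) − g(ε + ε·y) ≤ 6·ε³ and g(ε) + 2·g(ε·x) + g(ε·y) − f(ε + ε·y) ≥ −6·ε³, then |x² − y| ≤ 100·ε. -/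
theorem abs_sub_sq_le_of_cubic_error_s9 {δ r t : ℝ} {f : ℝ → ℝ}
    (hf : ∀ t : ℝ, |t| ≤ δ → |f t - t ^ 2| ≤ (1 / 10) * |t| ^ 3)
    (hr : r ≤ δ) (ht : |t| ≤ r) : |f t - t ^ 2| ≤ (1 / 10) * r ^ 3 :=
  (hf t (ht.trans hr)).trans (by gcongr)

theorem stmt_9 (ε : ℝ) (hε : 0 < ε) (f g : ℝ → ℝ)
    (hf : ∀ t : ℝ, |t| ≤ 2 * ε → |f t - t ^ 2| ≤ (1 / 10) * |t| ^ 3)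
    (hg : ∀ t : ℝ, |t| ≤ 2 * ε → |g t - t ^ 2| ≤ (1 / 10) * |t| ^ 3)
    (x y : ℝ) (hx : x ∈ Set.Icc (-1 : ℝ) 1) (hy : y ∈ Set.Icc (-1 : ℝ) 1)
    (hhigh : f ε + 2 * f (ε * x) + f (ε * y) - g (ε + ε * y) ≤ 6 * ε ^ 3)
    (hlow : -6 * ε ^ 3 ≤ g ε + 2 * g (ε * x) + g (ε * y) - f (ε + ε * y)) :
    |x ^ 2 - y| ≤ 100 * ε := by
  obtain ⟨hx₁, hx₂⟩ := hx
  obtain ⟨hy₁, hy₂⟩ := hy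
  have hr : ε ≤ 2 * ε := by linarith
  have b₁ : |ε| ≤ ε := (abs_of_pos hε).le
  have b₂ : |ε * x| ≤ ε := abs_le.2 ⟨by nlinarith, by nlinarith⟩
  have b₃ : |ε * y| ≤ ε := abs_le.2 ⟨by nlinarith, by nlinarith⟩
  have b₄ : |ε + ε * y| ≤ 2 * ε := abs_le.2 ⟨by nlinarith, by nlinarith⟩
  have f₁ := abs_le.1 (abs_sub_sq_le_of_cubic_error_s9 hf hr b₁)
  have f₂ := abs_le.1 (abs_sub_sq_le_of_cubic_error_s9 hf hr b₂)
  have f₃ := abs_le.1 (abs_sub_sq_le_of_cubic_error_s9 hf hr b₃)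
  have f₄ := abs_le.1 (abs_sub_sq_le_of_cubic_error_s9 hf le_rfl b₄)
  have g₁ := abs_le.1 (abs_sub_sq_le_of_cubic_error_s9 hg hr b₁)
  have g₂ := abs_le.1 (abs_sub_sq_le_of_cubic_error_s9 hg hr b₂)
  have g₃ := abs_le.1 (abs_sub_sq_le_of_cubic_error_s9 hg hr b₃)
  have g₄ := abs_le.1 (abs_sub_sq_le_of_cubic_error_s9 hg le_rfl b₄)
  have key : ε ^ 2 + 2 * (ε * x) ^ 2 + (ε * y) ^ 2 - (ε + ε * y) ^ 2
      = 2 * (ε ^ 2 * (x ^ 2 - y)) := by ring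
  have hcube : (2 * ε) ^ 3 = 8 * ε ^ 3 := by ring
  have hε₃ : 0 < ε ^ 3 := by positivity
  have hε₂ : 0 < ε ^ 2 := by positivity
  rw [abs_le]
  constructor
  · refine le_of_mul_le_mul_left ?_ hε₂
    have : ε ^ 2 * -(100 * ε) = -100 * ε ^ 3 := by ring
    linarith [g₁.2, g₂.2, g₃.2, f₄.1]
  · refine le_of_mul_le_mul_left ?_ hε₂
    have : ε ^ 2 * (100 * ε) = 100 * ε ^ 3 := by ring
    linarith [f₁.1, f₂.1, f₃.1, g₄.2]
end

section
/- For all real numbers x and y, there exists a real number z such that z² + (x + y)² = 1 and (z + x − y)² + (z − x + y)² = 1, if and only if 8·x·y = 1 and |x + y| ≤ 1. -/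
theorem stmt_11 (x y : ℝ) :
    (∃ z : ℝ, z ^ 2 + (x + y) ^ 2 = 1 ∧ (z + x - y) ^ 2 + (z - x + y) ^ 2 = 1) ↔
      (8 * x * y = 1 ∧ |x + y| ≤ 1) := by
  rw [← sq_le_one_iff_abs_le_one]
  constructor
  · rintro ⟨z, h₁, h₂⟩
    exact ⟨by linear_combination 2 * h₁ - h₂, by linarith [sq_nonneg z]⟩
  · rintro ⟨hxy, hle⟩
    have hz := Real.sq_sqrt (sub_nonneg.mpr hle)
    exact ⟨√(1 - (x + y) ^ 2), by linear_combination hz, by linear_combination 2 * hz - hxy⟩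
end
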